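/- Step (ii), well-posedness: Let the indices run over {0,1,…,n} and let L^{αβ}_A be first-order functions, symmetric in α,β, satisfying (int1) and (int2). For latin indices i,j ∈ {1,…,n}, define T^{ij}_{AB} = ∂^i_B L^{0j}_A + ∂^j_B L^{0i}_A − ∂^0_A L^{ij}_B and T̃^{ij}_{AB} = T^{ij}_{AB} − (1/2) ∫_0^1 Σ_C ψ^C_0 [((∂^i_A ∂^j_B + ∂^j_A ∂^i_B) L^{00}_C) ∘ φ_s] ds. Then ∂^0_D T̃^{ij}_{AB} = 0 for all i, j, A, B, D; i.e., T̃^{ij}_{AB} does not depend on the variables ψ^D_0. -/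

import Mathlib

/-!
Step (ii), well-posedness: with indices running over `{0,1,…,n}` and latin
indices `i,j ∈ {1,…,n}`, the functions
`T̃^{ij}_{AB} = T^{ij}_{AB} − (1/2)∫₀¹ Σ_C ψᶜ₀ [((∂ⁱ_A ∂ʲ_B + ∂ʲ_A ∂ⁱ_B) L^{00}_C) ∘ φ_s] ds`
do not depend on the variables `ψᴰ₀`, where
`T^{ij}_{AB} = ∂ⁱ_B L^{0j}_A + ∂ʲ_B L^{0i}_A − ∂⁰_A L^{ij}_B`.
-/

/-- The first-order jet-type space with `n+1` base indices:
`J = ℝ^{n+1} × ℝ^N × ℝ^{N×(n+1)}`. -/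
abbrev J (n N : ℕ) : Type :=
  (Fin (n+1) → ℝ) × (Fin N → ℝ) × (Fin N → Fin (n+1) → ℝ)

/-- `∂ᵅ_A f`: the partial derivative with respect to the variable `ψᴬ_α`. -/
noncomputable def pd {n N : ℕ} (A : Fin N) (α : Fin (n+1)) (f : J n N → ℝ) :
    J n N → ℝ :=
  fun p => fderiv ℝ f p (0, 0, Pi.single A (Pi.single α (1 : ℝ)))

/-- `φ_s : J → J`, fixing all coordinates except `ψᴬ₀ ↦ s ψᴬ₀`. -/
def phi {n N : ℕ} (s : ℝ) (p : J n N) : J n N :=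
  (p.1, p.2.1, fun A α => if α = 0 then s * p.2.2 A α else p.2.2 A α)

/-- `T^{ij}_{AB} = ∂ⁱ_B L^{0j}_A + ∂ʲ_B L^{0i}_A − ∂⁰_A L^{ij}_B`
(latin indices `i, j` are the indices `1,…,n`, realized via `Fin.succ`). -/
noncomputable def Tc {n N : ℕ}
    (L : Fin (n+1) → Fin (n+1) → Fin N → J n N → ℝ)
    (i j : Fin n) (A B : Fin N) : J n N → ℝ :=
  fun p => pd B i.succ (L 0 j.succ A) p + pd B j.succ (L 0 i.succ A) p
    - pd A 0 (L i.succ j.succ B) p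

/-- `T̃^{ij}_{AB}`, the corrected version of `T^{ij}_{AB}`. -/
noncomputable def Tct {n N : ℕ}
    (L : Fin (n+1) → Fin (n+1) → Fin N → J n N → ℝ)
    (i j : Fin n) (A B : Fin N) : J n N → ℝ :=
  fun p => Tc L i j A B p - (1/2) * ∫ s in (0:ℝ)..1, ∑ C, p.2.2 C 0 *
    ((fun q => pd A i.succ (pd B j.succ (L 0 0 C)) q
        + pd A j.succ (pd B i.succ (L 0 0 C)) q) (phi s p))

lemma contDiff_pd {n N : ℕ} (A : Fin N) (α : Fin (n+1)) {f : J n N → ℝ}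
    (hf : ContDiff ℝ (⊤ : ℕ∞) f) : ContDiff ℝ (⊤ : ℕ∞) (pd A α f) :=
  (hf.fderiv_right (m := (⊤ : ℕ∞)) (by simp)).clm_apply contDiff_const

lemma differentiable_pd {n N : ℕ} (A : Fin N) (α : Fin (n+1)) {f : J n N → ℝ}
    (hf : ContDiff ℝ (⊤ : ℕ∞) f) : Differentiable ℝ (pd A α f) :=
  (contDiff_pd A α hf).differentiable (by simp)

lemma pd_add {n N : ℕ} (A : Fin N) (α : Fin (n+1)) {f g : J n N → ℝ}
    (hf : Differentiable ℝ f) (hg : Differentiable ℝ g) (p : J n N) :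
    pd A α (fun q => f q + g q) p = pd A α f p + pd A α g p := by
  simp only [pd]
  rw [fderiv_fun_add (hf p) (hg p)]
  rfl

lemma pd_sub {n N : ℕ} (A : Fin N) (α : Fin (n+1)) {f g : J n N → ℝ}
    (hf : Differentiable ℝ f) (hg : Differentiable ℝ g) (p : J n N) :
    pd A α (fun q => f q - g q) p = pd A α f p - pd A α g p := by
  simp only [pd]
  rw [fderiv_fun_sub (hf p) (hg p)]
  rfl

/-- Partial derivatives of a smooth function commute. -/
lemma pd_comm {n N : ℕ} (A B : Fin N) (α β : Fin (n+1)) {f : J n N → ℝ}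
    (hf : ContDiff ℝ (⊤ : ℕ∞) f) (p : J n N) :
    pd A α (pd B β f) p = pd B β (pd A α f) p := by
  have hd : DifferentiableAt ℝ (fderiv ℝ f) p :=
    (hf.fderiv_right (m := (⊤ : ℕ∞)) (by simp)).differentiable (by simp) p
  have key (v w : J n N) :
      fderiv ℝ (fun q => fderiv ℝ f q v) p w = fderiv ℝ (fderiv ℝ f) p w v := by
    rw [fderiv_clm_apply hd (differentiableAt_const v)]
    simp
  have hs : IsSymmSndFDerivAt ℝ f p :=
    hf.contDiffAt.isSymmSndFDerivAt (by simpa using WithTop.coe_le_coe.2 (le_top (a := (2 : ℕ∞))))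
  unfold pd
  rw [key, key]
  exact hs _ _

lemma phi_eq_add_smul {n N : ℕ} (s : ℝ) (p : J n N) :
    phi s p = phi 0 p +
      s • ∑ C, p.2.2 C 0 • ((0, 0, Pi.single C (Pi.single 0 (1 : ℝ))) : J n N) := by
  have h : ∑ C, p.2.2 C 0 • ((0, 0, Pi.single C (Pi.single 0 (1 : ℝ))) : J n N)
      = (0, 0, fun A α => if α = 0 then p.2.2 A 0 else 0) := by
    refine Prod.ext ?_ (Prod.ext ?_ ?_)
    · simp [Prod.fst_sum]
    · simp [Prod.fst_sum, Prod.snd_sum]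
    · funext A α
      simp only [Prod.snd_sum, Prod.smul_snd, Finset.sum_apply, Pi.smul_apply]
      rw [Finset.sum_eq_single A]
      · by_cases hα : α = 0 <;> simp [hα]
      · intro C _ hC
        simp [Pi.single_eq_of_ne hC.symm]
      · simp
  rw [h]
  refine Prod.ext ?_ (Prod.ext ?_ ?_)
  · simp [phi]
  · simp [phi]
  · funext A α
    by_cases hα : α = 0 <;> simp [phi, hα]

lemma phi_one {n N : ℕ} (p : J n N) : phi 1 p = p := by
  simp [phi]

lemma phi_zero_add_smul {n N : ℕ} (D : Fin N) (t : ℝ) (p : J n N) :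
    phi 0 (p + t • ((0, 0, Pi.single D (Pi.single 0 (1 : ℝ))) : J n N)) = phi 0 p := by
  refine Prod.ext ?_ (Prod.ext ?_ ?_)
  · simp [phi]
  · simp [phi]
  · funext A α
    by_cases hα : α = 0
    · simp [phi, hα]
    · by_cases hA : A = D
      · subst hA
        simp [phi, hα]
      · simp [phi, hα, hA]

lemma continuous_phi_left {n N : ℕ} (p : J n N) : Continuous fun s : ℝ => phi s p := by
  rw [funext fun s => phi_eq_add_smul s p]
  fun_prop

lemma differentiable_phi {n N : ℕ} (s : ℝ) :
    Differentiable ℝ (phi s : J n N → J n N) := by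
  unfold phi
  refine differentiable_fst.prodMk (Differentiable.prodMk (by fun_prop) ?_)
  refine differentiable_pi.2 fun A => differentiable_pi.2 fun α => ?_
  split_ifs <;> fun_prop

/-- The derivative of `f` along the curve `s ↦ φ_s p`. -/
lemma hasDerivAt_comp_phi {n N : ℕ} {f : J n N → ℝ} (hf : Differentiable ℝ f)
    (p : J n N) (s : ℝ) :
    HasDerivAt (fun t => f (phi t p)) (∑ C, p.2.2 C 0 * pd C 0 f (phi s p)) s := by
  set v : J n N := ∑ C, p.2.2 C 0 • ((0, 0, Pi.single C (Pi.single 0 (1 : ℝ))) : J n N) with hv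
  have h : HasDerivAt (fun t : ℝ => phi t p) v s := by
    rw [funext fun t => phi_eq_add_smul t p, ← hv]
    simpa using ((hasDerivAt_id s).smul_const v).const_add (phi 0 p)
  have h' := (hf (phi s p)).hasFDerivAt.comp_hasDerivAt s h
  rw [hv, map_sum] at h'
  simp only [map_smul, smul_eq_mul] at h'
  exact h'

/-- Functions pulled back along `φ_0` do not depend on the variables `ψᴰ₀`. -/
lemma pd_zero_comp_phi_zero {n N : ℕ} {f : J n N → ℝ} (hf : Differentiable ℝ f)
    (D : Fin N) (p : J n N) : pd D 0 (fun q => f (phi 0 q)) p = 0 := by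
  have hd : DifferentiableAt ℝ (fun q => f (phi 0 q)) p := (hf.comp (differentiable_phi 0)) p
  unfold pd
  rw [← hd.lineDeriv_eq_fderiv]
  simp only [lineDeriv, phi_zero_add_smul, deriv_const]

lemma contDiff_Tc {n N : ℕ} {L : Fin (n+1) → Fin (n+1) → Fin N → J n N → ℝ}
    (hL : ∀ α β A, ContDiff ℝ (⊤ : ℕ∞) (L α β A)) (i j : Fin n) (A B : Fin N) :
    ContDiff ℝ (⊤ : ℕ∞) (Tc L i j A B) :=
  ((contDiff_pd _ _ (hL _ _ _)).add (contDiff_pd _ _ (hL _ _ _))).sub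
    (contDiff_pd _ _ (hL _ _ _))

/-- The case `ρ = σ = 0` of the second integrability condition, as a formula for `∂⁰_C T`. -/
lemma pd_zero_Tc {n N : ℕ} {L : Fin (n+1) → Fin (n+1) → Fin N → J n N → ℝ}
    (hL : ∀ α β A, ContDiff ℝ (⊤ : ℕ∞) (L α β A))
    (hint2 : ∀ (μ ν ρ σ : Fin (n+1)) (A B C : Fin N) (p : J n N),
      pd B μ (fun q => pd C ρ (L σ ν A) q + pd C σ (L ρ ν A) q) p
      + pd B ν (fun q => pd C ρ (L σ μ A) q + pd C σ (L ρ μ A) q) p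
      - (pd A μ (pd B ν (L σ ρ C)) p + pd A ν (pd B μ (L σ ρ C)) p)
      - (pd A ρ (pd C σ (L μ ν B)) p + pd A σ (pd C ρ (L μ ν B)) p) = 0)
    (i j : Fin n) (A B C : Fin N) (p : J n N) :
    pd A i.succ (pd B j.succ (L 0 0 C)) p + pd A j.succ (pd B i.succ (L 0 0 C)) p
      = 2 * pd C 0 (Tc L i j A B) p := by
  have hd (E : Fin N) (ε α β : Fin (n+1)) (F : Fin N) : Differentiable ℝ (pd E ε (L α β F)) :=
    differentiable_pd E ε (hL α β F)
  have h := hint2 i.succ j.succ 0 0 A B C p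
  rw [pd_add _ _ (hd _ _ _ _ _) (hd _ _ _ _ _), pd_add _ _ (hd _ _ _ _ _) (hd _ _ _ _ _),
    pd_comm B C _ _ (hL _ _ _), pd_comm B C _ _ (hL _ _ _), pd_comm A C 0 0 (hL _ _ _)] at h
  have hT : pd C 0 (Tc L i j A B) p = pd C 0 (pd B i.succ (L 0 j.succ A)) p
      + pd C 0 (pd B j.succ (L 0 i.succ A)) p - pd C 0 (pd A 0 (L i.succ j.succ B)) p := by
    unfold Tc
    rw [pd_sub _ _ ((hd _ _ _ _ _).fun_add (hd _ _ _ _ _)) (hd _ _ _ _ _),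
      pd_add _ _ (hd _ _ _ _ _) (hd _ _ _ _ _)]
  rw [hT]
  linarith

theorem step_ii_well_posed (n N : ℕ) (hn : 0 < n) (hN : 0 < N)
    (L : Fin (n+1) → Fin (n+1) → Fin N → J n N → ℝ)
    (hLsmooth : ∀ α β A, ContDiff ℝ (⊤ : ℕ∞) (L α β A))
    (hLsym : ∀ α β A, L α β A = L β α A)
    (hint1 : ∀ (μ ν ρ : Fin (n+1)) (A B : Fin N) (p : J n N),
      pd B ρ (L μ ν A) p + pd B μ (L ρ ν A) p + pd B ν (L μ ρ A) p =
      pd A ρ (L μ ν B) p + pd A μ (L ρ ν B) p + pd A ν (L μ ρ B) p)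
    (hint2 : ∀ (μ ν ρ σ : Fin (n+1)) (A B C : Fin N) (p : J n N),
      pd B μ (fun q => pd C ρ (L σ ν A) q + pd C σ (L ρ ν A) q) p
      + pd B ν (fun q => pd C ρ (L σ μ A) q + pd C σ (L ρ μ A) q) p
      - (pd A μ (pd B ν (L σ ρ C)) p + pd A ν (pd B μ (L σ ρ C)) p)
      - (pd A ρ (pd C σ (L μ ν B)) p + pd A σ (pd C ρ (L μ ν B)) p) = 0) :
    ∀ (i j : Fin n) (A B D : Fin N) (p : J n N),
      pd D 0 (Tct L i j A B) p = 0 := by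
  intro i j A B D p
  have hT := contDiff_Tc hLsmooth i j A B
  have hTd : Differentiable ℝ (Tc L i j A B) := hT.differentiable (by simp)
  have hTct : Tct L i j A B = fun q => Tc L i j A B (phi 0 q) := by
    funext q
    have hcont : Continuous fun s : ℝ => ∑ C, q.2.2 C 0 * pd C 0 (Tc L i j A B) (phi s q) :=
      continuous_finsetSum _ fun C _ => continuous_const.mul
        ((contDiff_pd C 0 hT).continuous.comp (continuous_phi_left q))
    have hftc := intervalIntegral.integral_eq_sub_of_hasDerivAt
      (fun s _ => hasDerivAt_comp_phi hTd q s) (hcont.intervalIntegrable 0 1)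
    simp only [Tct, pd_zero_Tc hLsmooth hint2, mul_left_comm _ (2 : ℝ), ← Finset.mul_sum,
      intervalIntegral.integral_const_mul, hftc, phi_one]
    ring
  rw [hTct]
  exact pd_zero_comp_phi_zero hTd D p
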